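/- arXiv:2312.10814 — 4 statements merged into one kernel-verified Lean document; each statement's English description precedes it below -/
import Mathlib

section
/- Let Φ denote the standard normal CDF and logit(p) = log p − log(1−p) for p ∈ (0,1). Then lim_{x→∞} [logit(Φ(x)) − x²/2 − log(√(2π)·x)] = 0. -/
open Filter Real

/-- The standard normal CDF: Φ(x) = ∫_{−∞}^{x} e^{−t²/2}/√(2π) dt. -/
noncomputable def stdNormCDF (x : ℝ) : ℝ :=
  ∫ t in Set.Iic x, Real.exp (-t ^ 2 / 2) / Real.sqrt (2 * Real.pi)

/-- logit(p) = log p − log(1−p). -/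
noncomputable def logit (p : ℝ) : ℝ := Real.log p - Real.log (1 - p)

open MeasureTheory ProbabilityTheory Topology

lemma gaussianPDFReal_zero_one (x : ℝ) :
    gaussianPDFReal 0 1 x = exp (-x ^ 2 / 2) / √(2 * π) := by
  simp [gaussianPDFReal_def, div_eq_inv_mul]

lemma stdNormCDF_eq_setIntegral_gaussianPDFReal (x : ℝ) :
    stdNormCDF x = ∫ t in Set.Iic x, gaussianPDFReal 0 1 t := by
  simp only [stdNormCDF, gaussianPDFReal_zero_one]

lemma hasDerivAt_gaussianPDFReal_zero_one (x : ℝ) :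
    HasDerivAt (gaussianPDFReal 0 1) (-x * gaussianPDFReal 0 1 x) x := by
  have h : HasDerivAt (fun t : ℝ => -t ^ 2 / 2) (-x) x :=
    ((hasDerivAt_pow 2 x).neg.div_const 2).congr_deriv (by norm_num; ring)
  rw [funext gaussianPDFReal_zero_one]
  exact (h.exp.div_const _).congr_deriv (by ring)

lemma tendsto_stdNormCDF_atTop : Tendsto stdNormCDF atTop (𝓝 1) := by
  have h := (aecover_Iic (μ := volume) (tendsto_id (α := ℝ) (x := atTop))
    ).integral_tendsto_of_countably_generated (integrable_gaussianPDFReal 0 1)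
  rw [integral_gaussianPDFReal_eq_one 0 one_ne_zero] at h
  exact h.congr fun x => (stdNormCDF_eq_setIntegral_gaussianPDFReal x).symm

lemma hasDerivAt_stdNormCDF (x : ℝ) :
    HasDerivAt stdNormCDF (gaussianPDFReal 0 1 x) x := by
  have hcont : Continuous (gaussianPDFReal 0 1) :=
    continuous_iff_continuousAt.2 fun y => (hasDerivAt_gaussianPDFReal_zero_one y).continuousAt
  have hint := integrable_gaussianPDFReal 0 1
  have heq : stdNormCDF = fun y => stdNormCDF 0 + ∫ t in (0 : ℝ)..y, gaussianPDFReal 0 1 t := by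
    funext y
    rw [← intervalIntegral.integral_Iic_sub_Iic hint.integrableOn hint.integrableOn]
    simp only [stdNormCDF_eq_setIntegral_gaussianPDFReal]
    ring
  rw [heq]
  exact (hcont.integral_hasStrictDerivAt 0 x).hasDerivAt.const_add _

/-- The leading asymptotics of the Mills ratio of the standard normal distribution. -/
lemma tendsto_one_sub_stdNormCDF_div :
    Tendsto (fun x => (1 - stdNormCDF x) / (gaussianPDFReal 0 1 x / x)) atTop (𝓝 1) := by
  have hpos (x : ℝ) : 0 < gaussianPDFReal 0 1 x := gaussianPDFReal_pos 0 1 x one_ne_zero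
  have hinv : Tendsto (fun x : ℝ => 1 / x ^ 2) atTop (𝓝 0) := by
    simpa using tendsto_pow_neg_atTop (𝕜 := ℝ) two_ne_zero
  refine HasDerivAt.lhopital_zero_atTop (f' := fun x => -gaussianPDFReal 0 1 x)
    (g' := fun x => -(gaussianPDFReal 0 1 x * (1 + 1 / x ^ 2)))
    (.of_forall fun x => (hasDerivAt_stdNormCDF x).const_sub 1) ?_ ?_ ?_ ?_ ?_
  · filter_upwards [eventually_gt_atTop 0] with x hx
    refine ((hasDerivAt_gaussianPDFReal_zero_one x).div (hasDerivAt_id x) hx.ne').congr_deriv ?_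
    simp only [id]
    field_simp
    ring
  · refine .of_forall fun x => neg_ne_zero.2 (mul_pos (hpos x) (by positivity)).ne'
  · simpa using tendsto_stdNormCDF_atTop.const_sub 1
  · refine squeeze_zero' (g := fun x : ℝ => (√(2 * π))⁻¹ / x) ?_ ?_
      (tendsto_const_nhds.div_atTop tendsto_id)
    · filter_upwards [eventually_gt_atTop 0] with x hx
      exact (div_pos (hpos x) hx).le
    · filter_upwards [eventually_gt_atTop 0] with x hx
      rw [gaussianPDFReal_zero_one, div_eq_mul_inv (exp _)]
      gcongr
      exact mul_le_of_le_one_left (by positivity) (exp_le_one_iff.2 (by nlinarith [sq_nonneg x]))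
  · have h := (hinv.const_add 1).inv₀ (by norm_num)
    simp only [add_zero, inv_one] at h
    refine h.congr fun x => ?_
    rw [neg_div_neg_eq, div_mul_cancel_left₀ (hpos x).ne']

theorem stmt3 :
    Tendsto (fun x : ℝ =>
      logit (stdNormCDF x) - x ^ 2 / 2 - Real.log (Real.sqrt (2 * Real.pi) * x))
      atTop (nhds 0) := by
  have hM := tendsto_one_sub_stdNormCDF_div
  have h := (tendsto_stdNormCDF_atTop.log one_ne_zero).sub (hM.log one_ne_zero)
  rw [log_one, sub_zero] at h
  refine h.congr' ?_
  filter_upwards [hM.eventually_ne one_ne_zero, eventually_gt_atTop 0] with x hx hx0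
  have hsqrt : √(2 * π) ≠ 0 := by positivity
  have hcdf : 1 - stdNormCDF x ≠ 0 := fun h0 => hx (by rw [h0, zero_div])
  rw [gaussianPDFReal_zero_one, logit, log_div hcdf (by positivity), log_div (by positivity) hx0.ne',
    log_div (exp_ne_zero _) hsqrt, log_exp, log_mul hsqrt hx0.ne']
  ring
end

section
/- Let Φ denote the standard normal CDF and logit(p) = log p − log(1−p) for p ∈ (0,1). For any real constants a < 0 and b, the function g(t) = logit(Φ(a√t + b)) is differentiable for sufficiently large t > 0 and its derivative satisfies lim_{t→∞} g′(t) = −a²/2. (This is Theorem 1(b) of the paper for a one-sided hypothesis with θ outside the interval, i.e. δ_L = −∞ and θ > δ_U.) -/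
open Filter Real

theorem integrable_exp_neg_sq_half_div :
    MeasureTheory.Integrable (fun t : ℝ => exp (-t ^ 2 / 2) / √(2 * π)) := by
  have h := (integrable_exp_neg_mul_sq (b := 1 / 2) (by norm_num)).div_const (√(2 * π))
  refine h.congr (Eventually.of_forall fun t => ?_)
  simp only
  congr 2
  ring

theorem stdNormCDF_eq_add_intervalIntegral (x : ℝ) :
    stdNormCDF x = stdNormCDF 0 + ∫ t in (0 : ℝ)..x, exp (-t ^ 2 / 2) / √(2 * π) := by
  have h := intervalIntegral.integral_Iic_sub_Iic
    (integrable_exp_neg_sq_half_div.integrableOn (s := Set.Iic 0))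
    (integrable_exp_neg_sq_half_div.integrableOn (s := Set.Iic x))
  unfold stdNormCDF
  linarith

theorem hasDerivAt_stdNormCDF_s6 (x : ℝ) :
    HasDerivAt stdNormCDF (exp (-x ^ 2 / 2) / √(2 * π)) x := by
  have hc : Continuous fun t : ℝ => exp (-t ^ 2 / 2) / √(2 * π) := by fun_prop
  have h := (hc.integral_hasStrictDerivAt 0 x).hasDerivAt.const_add (stdNormCDF 0)
  exact h.congr_of_eventuallyEq (Eventually.of_forall stdNormCDF_eq_add_intervalIntegral)

theorem tendsto_stdNormCDF_atBot : Tendsto stdNormCDF atBot (nhds 0) := by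
  have h := MeasureTheory.intervalIntegral_tendsto_integral_Iic (0 : ℝ)
    integrable_exp_neg_sq_half_div.integrableOn tendsto_id
  have h' := h.const_sub (stdNormCDF 0)
  rw [show (∫ t in Set.Iic (0 : ℝ), exp (-t ^ 2 / 2) / √(2 * π)) = stdNormCDF 0 from rfl,
    sub_self] at h'
  refine h'.congr fun x => ?_
  rw [stdNormCDF_eq_add_intervalIntegral x, intervalIntegral.integral_symm 0]
  simp

theorem stdNormCDF_pos (x : ℝ) : 0 < stdNormCDF x := by
  have hmono : StrictMono stdNormCDF := strictMono_of_deriv_pos fun y => by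
    rw [(hasDerivAt_stdNormCDF_s6 y).deriv]
    positivity
  have h0 : 0 ≤ stdNormCDF (x - 1) := MeasureTheory.integral_nonneg fun t => by positivity
  exact h0.trans_lt (hmono (by linarith))

theorem hasDerivAt_exp_neg_sq_half_div (x : ℝ) :
    HasDerivAt (fun t : ℝ => exp (-t ^ 2 / 2) / √(2 * π))
      (-x * (exp (-x ^ 2 / 2) / √(2 * π))) x := by
  have h := ((((hasDerivAt_pow 2 x).neg).div_const 2).exp).div_const (√(2 * π))
  refine h.congr_deriv ?_
  simp only [Pi.neg_apply]
  push_cast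
  ring

theorem tendsto_exp_neg_sq_half_div_atBot :
    Tendsto (fun t : ℝ => exp (-t ^ 2 / 2) / √(2 * π)) atBot (nhds 0) := by
  have h : Tendsto (fun t : ℝ => -t ^ 2 / 2) atBot atBot := by
    have h2 : Tendsto (fun t : ℝ => t ^ 2) atBot atTop := by
      simpa [Function.comp_def] using
        (tendsto_pow_atTop (α := ℝ) two_ne_zero).comp tendsto_neg_atBot_atTop
    exact (tendsto_neg_atTop_atBot.comp h2).atBot_div_const two_pos
  simpa using (tendsto_exp_atBot.comp h).div_const (√(2 * π))

/-- Mills ratio asymptotics for the lower tail of the standard normal distribution. -/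
theorem tendsto_stdNormCDF_div_atBot :
    Tendsto (fun x : ℝ => stdNormCDF x / (exp (-x ^ 2 / 2) / √(2 * π) * (-x)⁻¹))
      atBot (nhds 1) := by
  have hinv : Tendsto (fun x : ℝ => (-x)⁻¹) atBot (nhds 0) :=
    tendsto_inv_atTop_zero.comp tendsto_neg_atBot_atTop
  refine HasDerivAt.lhopital_zero_atBot (f' := fun x => exp (-x ^ 2 / 2) / √(2 * π))
    (g' := fun x => exp (-x ^ 2 / 2) / √(2 * π) * (1 + (-x)⁻¹ ^ 2))
    (Eventually.of_forall hasDerivAt_stdNormCDF_s6) ?_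
    (Eventually.of_forall fun x => by positivity) tendsto_stdNormCDF_atBot ?_ ?_
  · filter_upwards [eventually_lt_atBot 0] with x hx
    refine ((hasDerivAt_exp_neg_sq_half_div x).mul
      ((hasDerivAt_neg x).inv (neg_ne_zero.mpr hx.ne))).congr_deriv ?_
    have := hx.ne
    simp only [Pi.inv_apply]
    field_simp
  · simpa using tendsto_exp_neg_sq_half_div_atBot.mul hinv
  · have h : Tendsto (fun x : ℝ => (1 + (-x)⁻¹ ^ 2)⁻¹) atBot (nhds 1) := by
      simpa using ((hinv.pow 2).const_add 1).inv₀ (by norm_num)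
    refine h.congr fun x => ?_
    have h1 : exp (-x ^ 2 / 2) / √(2 * π) ≠ 0 := by positivity
    rw [div_mul_eq_div_div, div_self h1, one_div]

theorem hasDerivAt_logit {p : ℝ} (h0 : p ≠ 0) (h1 : 1 - p ≠ 0) :
    HasDerivAt logit (1 / (p * (1 - p))) p := by
  refine ((hasDerivAt_log h0).sub (((hasDerivAt_id p).const_sub 1).log h1)).congr_deriv ?_
  simp only [id]
  field_simp
  ring

/-- For a < 0 and b real, g(t) = logit(Φ(a√t + b)) is differentiable for
sufficiently large t > 0 and lim_{t→∞} g′(t) = −a²/2. -/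
theorem stmt6 (a b : ℝ) (ha : a < 0) :
    (∀ᶠ t : ℝ in atTop,
        DifferentiableAt ℝ (fun t : ℝ => logit (stdNormCDF (a * Real.sqrt t + b))) t) ∧
      Tendsto (deriv fun t : ℝ => logit (stdNormCDF (a * Real.sqrt t + b)))
        atTop (nhds (-a ^ 2 / 2)) := by
  have hu : Tendsto (fun t : ℝ => a * √t + b) atTop atBot :=
    tendsto_atBot_add_const_right _ _ (tendsto_sqrt_atTop.const_mul_atTop_of_neg ha)
  have hp : Tendsto (fun t : ℝ => stdNormCDF (a * √t + b)) atTop (nhds 0) :=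
    tendsto_stdNormCDF_atBot.comp hu
  have hderiv : ∀ᶠ t : ℝ in atTop,
      HasDerivAt (fun t : ℝ => logit (stdNormCDF (a * √t + b)))
        (1 / (stdNormCDF (a * √t + b) * (1 - stdNormCDF (a * √t + b))) *
          (exp (-(a * √t + b) ^ 2 / 2) / √(2 * π) * (a * (1 / (2 * √t))))) t := by
    filter_upwards [eventually_gt_atTop 0, hp.eventually_lt_const one_pos] with t ht hlt
    exact (hasDerivAt_logit (stdNormCDF_pos _).ne' (sub_pos.mpr hlt).ne').comp t
      ((hasDerivAt_stdNormCDF_s6 _).comp t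
        (((hasDerivAt_sqrt ht.ne').const_mul a).add_const b))
  refine ⟨hderiv.mono fun t ht => ht.differentiableAt, ?_⟩
  have hmills := (tendsto_stdNormCDF_div_atBot.comp hu).inv₀ one_ne_zero
  have hq : Tendsto (fun t : ℝ => (1 - stdNormCDF (a * √t + b))⁻¹) atTop (nhds 1) := by
    simpa using (hp.const_sub 1).inv₀ (by norm_num)
  have hlin : Tendsto (fun t : ℝ => -(a + b * (√t)⁻¹) * (a / 2)) atTop
      (nhds (-a ^ 2 / 2)) := by
    have h := ((((tendsto_inv_atTop_zero.comp tendsto_sqrt_atTop).const_mul b).const_add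
      a).neg).mul_const (a / 2)
    rwa [show -(a + b * 0) * (a / 2) = -a ^ 2 / 2 by ring] at h
  have hprod := (hmills.mul hq).mul hlin
  rw [inv_one, one_mul, one_mul] at hprod
  refine hprod.congr' ?_
  filter_upwards [hderiv, eventually_gt_atTop 0, hp.eventually_lt_const one_pos,
    hu.eventually_lt_atBot 0] with t hd ht hlt hneg
  rw [hd.deriv]
  have hs : √t ≠ 0 := (sqrt_pos.mpr ht).ne'
  have hp0 := (stdNormCDF_pos (a * √t + b)).ne'
  have hp1 := (sub_pos.mpr hlt).ne'
  have he : exp (-(a * √t + b) ^ 2 / 2) / √(2 * π) ≠ 0 := by positivity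
  have hu0 := hneg.ne
  simp only [Function.comp_apply]
  generalize exp (-(a * √t + b) ^ 2 / 2) / √(2 * π) = e at *
  generalize stdNormCDF (a * √t + b) = p at *
  have hslope : a + b * (√t)⁻¹ = (a * √t + b) / √t := by field_simp
  rw [hslope]
  generalize a * √t + b = u at *
  field_simp
end

section
/- Let Φ denote the standard normal CDF and let a_L < a_U < 0 and b be real constants. Define f(t) = Φ(a_U√t + b) − Φ(a_L√t + b) for t > 0. Then lim_{t→∞} (1/t)·log f(t) = −a_U²/2. -/
open Filter Real

theorem continuous_stdNormDensity :
    Continuous fun t : ℝ => exp (-t ^ 2 / 2) / √(2 * π) := by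
  fun_prop

theorem integrable_stdNormDensity :
    MeasureTheory.Integrable fun t : ℝ => exp (-t ^ 2 / 2) / √(2 * π) := by
  refine ((integrable_exp_neg_mul_sq (b := 1 / 2) (by norm_num)).div_const √(2 * π)).congr
    (.of_forall fun t => ?_)
  ring_nf

theorem stdNormDensity_le {x y : ℝ} (hxy : x ≤ y) (hy : y ≤ 0) :
    exp (-x ^ 2 / 2) / √(2 * π) ≤ exp (-y ^ 2 / 2) / √(2 * π) := by
  have : -x ^ 2 / 2 ≤ -y ^ 2 / 2 := by nlinarith
  gcongr

theorem stdNormCDF_sub (x y : ℝ) :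
    stdNormCDF y - stdNormCDF x = ∫ t in x..y, exp (-t ^ 2 / 2) / √(2 * π) :=
  intervalIntegral.integral_Iic_sub_Iic integrable_stdNormDensity.integrableOn
    integrable_stdNormDensity.integrableOn

theorem stdNormCDF_mono : Monotone stdNormCDF := fun x y hxy => by
  rw [← sub_nonneg, stdNormCDF_sub]
  exact intervalIntegral.integral_nonneg hxy fun t _ => by positivity

theorem stdNormCDF_sub_le {x y : ℝ} (hxy : x ≤ y) (hy : y ≤ 0) :
    stdNormCDF y - stdNormCDF x ≤ (y - x) * (exp (-y ^ 2 / 2) / √(2 * π)) := by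
  rw [stdNormCDF_sub, ← smul_eq_mul (y - x), ← intervalIntegral.integral_const]
  exact intervalIntegral.integral_mono_on hxy (continuous_stdNormDensity.intervalIntegrable _ _)
    (by simp) fun t ht => stdNormDensity_le ht.2 hy

theorem le_stdNormCDF_sub {x y : ℝ} (hxy : x ≤ y) (hy : y ≤ 0) :
    (y - x) * (exp (-x ^ 2 / 2) / √(2 * π)) ≤ stdNormCDF y - stdNormCDF x := by
  rw [stdNormCDF_sub, ← smul_eq_mul (y - x), ← intervalIntegral.integral_const]
  exact intervalIntegral.integral_mono_on hxy (by simp)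
    (continuous_stdNormDensity.intervalIntegrable _ _)
    fun t ht => stdNormDensity_le ht.1 (ht.2.trans hy)

theorem log_stdNormDensity (x : ℝ) :
    log (exp (-x ^ 2 / 2) / √(2 * π)) = -x ^ 2 / 2 - log √(2 * π) := by
  rw [log_div (exp_ne_zero _) (by positivity), log_exp]

theorem tendsto_quadratic_div_sq (a d k c : ℝ) :
    Tendsto (fun s : ℝ => 1 / s ^ 2 * (d * s + (-(a * s + k) ^ 2 / 2 - c))) atTop
      (nhds (-a ^ 2 / 2)) := by
  have h : Tendsto (fun s : ℝ => d * s⁻¹ + (-(a + k * s⁻¹) ^ 2 / 2 - c * s⁻¹ ^ 2)) atTop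
      (nhds (d * 0 + (-(a + k * 0) ^ 2 / 2 - c * 0 ^ 2))) := by
    have hcont : Continuous fun u : ℝ => d * u + (-(a + k * u) ^ 2 / 2 - c * u ^ 2) := by fun_prop
    exact (hcont.tendsto 0).comp tendsto_inv_atTop_zero
  have h0 : d * 0 + (-(a + k * 0) ^ 2 / 2 - c * 0 ^ 2) = -a ^ 2 / 2 := by ring
  rw [h0] at h
  refine h.congr' ?_
  filter_upwards [eventually_gt_atTop 0] with s hs
  field_simp

/-- For a_L < a_U < 0 and f(t) = Φ(a_U√t + b) − Φ(a_L√t + b),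
lim_{t→∞} (1/t)·log f(t) = −a_U²/2. -/
theorem stmt13 (aL aU b : ℝ) (haLU : aL < aU) (haU : aU < 0) :
    Tendsto (fun t : ℝ =>
        (1 / t) * Real.log
          (stdNormCDF (aU * Real.sqrt t + b) - stdNormCDF (aL * Real.sqrt t + b)))
      atTop (nhds (-aU ^ 2 / 2)) := by
  suffices h : Tendsto (fun s : ℝ =>
      1 / s ^ 2 * log (stdNormCDF (aU * s + b) - stdNormCDF (aL * s + b)))
      atTop (nhds (-aU ^ 2 / 2)) by
    refine (h.comp tendsto_sqrt_atTop).congr' ?_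
    filter_upwards [eventually_ge_atTop 0] with t ht
    simp only [Function.comp_apply, sq_sqrt ht]
  have hd : 0 < aU - aL := sub_pos.2 haLU
  have hneg : ∀ᶠ s : ℝ in atTop, aU * s + b ≤ 0 :=
    (tendsto_atBot_add_const_right _ b (tendsto_id.const_mul_atTop_of_neg haU)).eventually_le_atBot 0
  have hgap : ∀ᶠ s : ℝ in atTop, 1 ≤ (aU - aL) * s :=
    (tendsto_id.const_mul_atTop hd).eventually_ge_atTop 1
  refine tendsto_of_tendsto_of_tendsto_of_le_of_le'
    (tendsto_quadratic_div_sq aU 0 (b - 1) (log √(2 * π)))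
    (tendsto_quadratic_div_sq aU (aU - aL) b (log √(2 * π))) ?_ ?_
  · filter_upwards [hneg, hgap] with s hs hs'
    have h₁ := le_stdNormCDF_sub (sub_le_self (aU * s + b) zero_le_one) hs
    have h₂ : stdNormCDF (aL * s + b) ≤ stdNormCDF (aU * s + b - 1) :=
      stdNormCDF_mono (by linarith)
    rw [sub_sub_cancel, one_mul] at h₁
    have h₃ := log_le_log (by positivity) (h₁.trans (sub_le_sub_left h₂ _))
    rw [log_stdNormDensity] at h₃
    rw [zero_mul, zero_add, ← add_sub_assoc]
    gcongr
  · filter_upwards [hneg, hgap] with s hs hs'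
    have h₁ := stdNormCDF_sub_le (x := aL * s + b) (by linarith) hs
    have h₂ := le_stdNormCDF_sub (x := aL * s + b) (by linarith) hs
    have hw : aU * s + b - (aL * s + b) = (aU - aL) * s := by ring
    have hpos : 0 < (aU - aL) * s := by linarith
    rw [hw] at h₁ h₂
    have h₃ := log_le_log (lt_of_lt_of_le (by positivity) h₂) h₁
    rw [log_mul hpos.ne' (by positivity), log_stdNormDensity] at h₃
    have h₄ := log_le_sub_one_of_pos hpos
    gcongr
    linarith
end

section
/- Let Φ denote the standard normal CDF and logit(p) = log p − log(1−p) for p ∈ (0,1). Let a_L < 0 < a_U and b be real constants, and define f(t) = Φ(a_U√t + b) − Φ(a_L√t + b) for t > 0. Then lim_{t→∞} logit(f(t))/t = min{a_U², a_L²}/2; that is, the logit of the proxy posterior probability is asymptotically a linear function of the sample size, with slope min{a_U², a_L²}/2. -/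
open Filter Real

open MeasureTheory Set Topology

lemma integrable_stdNormPDF :
    Integrable (fun t : ℝ => Real.exp (-t ^ 2 / 2) / Real.sqrt (2 * Real.pi)) := by
  have h := (integrable_exp_neg_mul_sq (b := 1 / 2) (by norm_num)).div_const
    (Real.sqrt (2 * Real.pi))
  refine h.congr (Eventually.of_forall fun t => ?_)
  simp only
  congr 2
  ring

lemma integral_stdNormPDF :
    ∫ t : ℝ, Real.exp (-t ^ 2 / 2) / Real.sqrt (2 * Real.pi) = 1 := by
  have h : ∀ t : ℝ, Real.exp (-t ^ 2 / 2) = Real.exp (-(1 / 2) * t ^ 2) := fun t => by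
    congr 1
    ring
  simp_rw [integral_div, h, integral_gaussian]
  rw [show Real.pi / (1 / 2) = 2 * Real.pi by ring]
  exact div_self (by positivity)

lemma stdNormCDF_add_neg (x : ℝ) : stdNormCDF x + stdNormCDF (-x) = 1 := by
  have h := integral_comp_neg_Ioi x
    (fun t : ℝ => Real.exp (-t ^ 2 / 2) / Real.sqrt (2 * Real.pi))
  simp only [neg_sq] at h
  rw [stdNormCDF, stdNormCDF, ← h, ← integral_stdNormPDF, ← compl_Iic]
  exact integral_add_compl measurableSet_Iic integrable_stdNormPDF

/-- Gaussian (Chernoff) upper bound for the lower tail. -/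
lemma stdNormCDF_neg_le {x : ℝ} (hx : 0 ≤ x) : stdNormCDF (-x) ≤ Real.exp (-x ^ 2 / 2) := by
  have hint := (integrable_stdNormPDF.comp_sub_right (-x)).const_mul (Real.exp (-x ^ 2 / 2))
  calc stdNormCDF (-x)
      ≤ ∫ t in Iic (-x), Real.exp (-x ^ 2 / 2) *
          (Real.exp (-(t - -x) ^ 2 / 2) / Real.sqrt (2 * Real.pi)) := by
        refine setIntegral_mono_on integrable_stdNormPDF.integrableOn hint.integrableOn
          measurableSet_Iic fun t ht => ?_
        rw [← mul_div_assoc, ← Real.exp_add]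
        gcongr
        have : t ≤ -x := ht
        nlinarith
    _ ≤ ∫ t, Real.exp (-x ^ 2 / 2) *
          (Real.exp (-(t - -x) ^ 2 / 2) / Real.sqrt (2 * Real.pi)) :=
        setIntegral_le_integral hint (Eventually.of_forall fun t => by positivity)
    _ = Real.exp (-x ^ 2 / 2) := by
        rw [integral_const_mul, integral_sub_right_eq_self
          (fun t : ℝ => Real.exp (-t ^ 2 / 2) / Real.sqrt (2 * Real.pi)),
          integral_stdNormPDF, mul_one]

lemma le_stdNormCDF_neg {x : ℝ} (hx : 0 ≤ x) :
    Real.exp (-(x + 1) ^ 2 / 2) / Real.sqrt (2 * Real.pi) ≤ stdNormCDF (-x) := by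
  calc Real.exp (-(x + 1) ^ 2 / 2) / Real.sqrt (2 * Real.pi)
      = ∫ _ in Icc (-x - 1) (-x), Real.exp (-(x + 1) ^ 2 / 2) / Real.sqrt (2 * Real.pi) := by
        simp
    _ ≤ ∫ t in Icc (-x - 1) (-x), Real.exp (-t ^ 2 / 2) / Real.sqrt (2 * Real.pi) := by
        refine setIntegral_mono_on (by simp) integrable_stdNormPDF.integrableOn
          measurableSet_Icc fun t ht => ?_
        gcongr ?_ / _
        rw [Real.exp_le_exp]
        nlinarith [ht.1, ht.2]
    _ ≤ stdNormCDF (-x) :=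
        setIntegral_mono_set integrable_stdNormPDF.integrableOn
          (Eventually.of_forall fun t => by positivity) Icc_subset_Iic_self.eventuallyLE

lemma stdNormCDF_neg_pos {x : ℝ} (hx : 0 ≤ x) : 0 < stdNormCDF (-x) :=
  lt_of_lt_of_le (by positivity) (le_stdNormCDF_neg hx)

lemma tendsto_stdNormCDF_neg_atTop :
    Tendsto (fun x => stdNormCDF (-x)) atTop (𝓝 0) := by
  have h : Tendsto (fun x : ℝ => Real.exp (-x ^ 2 / 2)) atTop (𝓝 0) := by
    refine Real.tendsto_exp_atBot.comp ?_
    simp_rw [neg_div]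
    exact tendsto_neg_atTop_atBot.comp
      ((tendsto_pow_atTop two_ne_zero).atTop_div_const two_pos)
  refine tendsto_of_tendsto_of_tendsto_of_le_of_le' tendsto_const_nhds h ?_ ?_
  · filter_upwards [eventually_ge_atTop 0] with x hx using (stdNormCDF_neg_pos hx).le
  · filter_upwards [eventually_ge_atTop 0] with x hx using stdNormCDF_neg_le hx

/-- Logarithmic asymptotics of the lower Gaussian tail. -/
lemma tendsto_log_stdNormCDF_neg_div_sq :
    Tendsto (fun x => Real.log (stdNormCDF (-x)) / x ^ 2) atTop (𝓝 (-1 / 2)) := by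
  have hinv : Tendsto (fun x : ℝ => x⁻¹) atTop (𝓝 0) := tendsto_inv_atTop_zero
  have hlow : Tendsto (fun x : ℝ => -(1 + x⁻¹) ^ 2 / 2
      - Real.log (Real.sqrt (2 * Real.pi)) * x⁻¹ ^ 2) atTop (𝓝 (-1 / 2)) := by
    have := (((hinv.const_add 1).pow 2).neg.div_const 2).sub
      ((hinv.pow 2).const_mul (Real.log (Real.sqrt (2 * Real.pi))))
    simpa using this
  refine tendsto_of_tendsto_of_tendsto_of_le_of_le' hlow tendsto_const_nhds ?_ ?_
  · filter_upwards [eventually_gt_atTop 0] with x hx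
    have h := Real.log_le_log (by positivity) (le_stdNormCDF_neg hx.le)
    rw [Real.log_div (by positivity) (by positivity), Real.log_exp] at h
    rw [le_div_iff₀ (by positivity)]
    refine le_trans (le_of_eq ?_) h
    field_simp
  · filter_upwards [eventually_gt_atTop 0] with x hx
    have h := Real.log_le_log (stdNormCDF_neg_pos hx.le) (stdNormCDF_neg_le hx.le)
    rw [Real.log_exp] at h
    rw [div_le_iff₀ (by positivity)]
    linarith

lemma tendsto_mul_sqrt_add_atTop {c : ℝ} (hc : 0 < c) (d : ℝ) :
    Tendsto (fun t => c * Real.sqrt t + d) atTop atTop :=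
  tendsto_atTop_add_const_right _ _ (Real.tendsto_sqrt_atTop.const_mul_atTop hc)

lemma tendsto_log_stdNormCDF_neg_mul_sqrt_add_div {c : ℝ} (hc : 0 < c) (d : ℝ) :
    Tendsto (fun t => Real.log (stdNormCDF (-(c * Real.sqrt t + d))) / t) atTop
      (𝓝 (-c ^ 2 / 2)) := by
  have hx := tendsto_mul_sqrt_add_atTop hc d
  have hratio : Tendsto (fun t => (c + d * (Real.sqrt t)⁻¹) ^ 2) atTop (𝓝 (c ^ 2)) := by
    have := (((tendsto_inv_atTop_zero.comp Real.tendsto_sqrt_atTop).const_mul d).const_add c).pow 2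
    simpa using this
  have h := (tendsto_log_stdNormCDF_neg_div_sq.comp hx).mul hratio
  rw [show -1 / 2 * c ^ 2 = -c ^ 2 / 2 by ring] at h
  refine h.congr' ?_
  filter_upwards [eventually_gt_atTop 0, hx.eventually_gt_atTop 0] with t ht hpos
  have hs : 0 < Real.sqrt t := Real.sqrt_pos.2 ht
  have hst : (c + d * (Real.sqrt t)⁻¹) ^ 2 = (c * Real.sqrt t + d) ^ 2 / t := by
    conv_rhs => rw [← Real.sq_sqrt ht.le, Real.sqrt_sq hs.le]
    field_simp
  rw [Function.comp_apply, hst]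
  field_simp

/-- The larger of two exponential rates dominates their sum. -/
lemma Filter.Tendsto.log_add_div {p q : ℝ → ℝ} {a b : ℝ}
    (hp : ∀ᶠ t in atTop, 0 < p t) (hq : ∀ᶠ t in atTop, 0 < q t)
    (hpa : Tendsto (fun t => Real.log (p t) / t) atTop (𝓝 a))
    (hqb : Tendsto (fun t => Real.log (q t) / t) atTop (𝓝 b)) :
    Tendsto (fun t => Real.log (p t + q t) / t) atTop (𝓝 (max a b)) := by
  have hmax := hpa.max hqb
  have hupper : Tendsto (fun t => Real.log 2 / t + max (Real.log (p t) / t) (Real.log (q t) / t))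
      atTop (𝓝 (max a b)) := by
    simpa using (tendsto_id.const_div_atTop (Real.log 2)).add hmax
  refine tendsto_of_tendsto_of_tendsto_of_le_of_le' hmax hupper ?_ ?_
  · filter_upwards [hp, hq, eventually_gt_atTop 0] with t hp hq ht
    refine max_le ?_ ?_ <;> gcongr <;> linarith
  · filter_upwards [hp, hq, eventually_gt_atTop 0] with t hp hq ht
    rw [max_div_div_right ht.le, ← add_div]
    gcongr
    rcases le_total (p t) (q t) with h | h
    · refine le_trans ?_ (add_le_add_right (le_max_right _ _) _)
      rw [← Real.log_mul two_ne_zero hq.ne']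
      exact Real.log_le_log (by positivity) (by linarith)
    · refine le_trans ?_ (add_le_add_right (le_max_left _ _) _)
      rw [← Real.log_mul two_ne_zero hp.ne']
      exact Real.log_le_log (by positivity) (by linarith)

/-- For a_L < 0 < a_U and f(t) = Φ(a_U√t + b) − Φ(a_L√t + b),
lim_{t→∞} logit(f(t))/t = min{a_U², a_L²}/2. -/
theorem stmt14 (aL aU b : ℝ) (haL : aL < 0) (haU : 0 < aU) :
    Tendsto (fun t : ℝ =>
        logit (stdNormCDF (aU * Real.sqrt t + b) - stdNormCDF (aL * Real.sqrt t + b)) / t)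
      atTop (nhds (min (aU ^ 2) (aL ^ 2) / 2)) := by
  have hU := tendsto_mul_sqrt_add_atTop haU b
  have hL := tendsto_mul_sqrt_add_atTop (neg_pos.2 haL) (-b)
  set p : ℝ → ℝ := fun t => stdNormCDF (-(aU * Real.sqrt t + b)) with hp
  set q : ℝ → ℝ := fun t => stdNormCDF (-(-aL * Real.sqrt t + -b)) with hq
  have hf : ∀ t, stdNormCDF (aU * Real.sqrt t + b) - stdNormCDF (aL * Real.sqrt t + b)
      = 1 - (p t + q t) := fun t => by
    have hneg : aL * Real.sqrt t + b = -(-aL * Real.sqrt t + -b) := by ring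
    rw [eq_sub_of_add_eq (stdNormCDF_add_neg (aU * Real.sqrt t + b)), hneg]
    simp only [hp, hq]
    ring
  have hrate : Tendsto (fun t => Real.log (p t + q t) / t) atTop
      (𝓝 (max (-aU ^ 2 / 2) (-(-aL) ^ 2 / 2))) := by
    refine Filter.Tendsto.log_add_div ?_ ?_
      (tendsto_log_stdNormCDF_neg_mul_sqrt_add_div haU b)
      (tendsto_log_stdNormCDF_neg_mul_sqrt_add_div (neg_pos.2 haL) (-b))
    · filter_upwards [hU.eventually_ge_atTop 0] with t ht using stdNormCDF_neg_pos ht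
    · filter_upwards [hL.eventually_ge_atTop 0] with t ht using stdNormCDF_neg_pos ht
  have hone : Tendsto (fun t => 1 - (p t + q t)) atTop (𝓝 1) := by
    have := ((tendsto_stdNormCDF_neg_atTop.comp hU).add
      (tendsto_stdNormCDF_neg_atTop.comp hL)).const_sub 1
    rwa [add_zero, sub_zero] at this
  have hlog : Tendsto (fun t => Real.log (1 - (p t + q t)) / t) atTop (𝓝 0) :=
    (hone.log one_ne_zero).div_atTop tendsto_id
  have hlim := hlog.sub hrate
  rw [neg_sq, max_div_div_right zero_le_two, max_neg_neg, neg_div, zero_sub, neg_neg] at hlim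
  refine hlim.congr fun t => ?_
  rw [hf, logit, sub_sub_cancel, sub_div]
end
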